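/- Let n ≥ 1, 0 < α < n, 1 < p₁, p₂ < ∞. There is a constant C depending only on n, α, p₁, p₂ such that: whenever Q is a cube with center x_Q, f is a measurable function supported in Q with |f| ≤ |Q|^{−1/p₁} pointwise, g(y) = |Q| χ_{(2Q)^c}(y) |y − x_Q|^{−(n/p₂+n)}, and x ∈ (2nQ)^c, then |B_α(f, g)(x)| ≤ C |Q|^{1/p₁' + 1} |x − x_Q|^{−2n − n/p₂ + α}, where 1/p₁' = 1 − 1/p₁. -/

import Mathlib

open MeasureTheory Filter
open scoped ENNReal Topology

noncomputable section

/-- Euclidean space `ℝⁿ`. -/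
abbrev Rn (n : ℕ) := EuclideanSpace ℝ (Fin n)

/-- Axis-parallel closed cube with center `c` and side length `r`. -/
def cube (n : ℕ) (c : Rn n) (r : ℝ) : Set (Rn n) := {y | ∀ i, |y i - c i| ≤ r / 2}

/-- Average of `b` over a set `Q`. -/
def avg (n : ℕ) (b : Rn n → ℝ) (Q : Set (Rn n)) : ℝ :=
  (volume Q).toReal⁻¹ * ∫ x in Q, b x

/-- Mean oscillation of `b` over a set `Q`. -/
def osc (n : ℕ) (b : Rn n → ℝ) (Q : Set (Rn n)) : ℝ :=
  (volume Q).toReal⁻¹ * ∫ x in Q, |b x - avg n b Q|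

/-- The BMO seminorm `‖b‖_*`, as an extended real number (supremum of the mean
oscillations over all cubes). -/
def bmoNorm (n : ℕ) (b : Rn n → ℝ) : ℝ≥0∞ :=
  ⨆ (c : Rn n) (r : {r : ℝ // 0 < r}), ENNReal.ofReal (osc n b (cube n c r.1))

/-- `b ∈ BMO(ℝⁿ)`. -/
def MemBMO (n : ℕ) (b : Rn n → ℝ) : Prop :=
  LocallyIntegrable b volume ∧ bmoNorm n b < ⊤

/-- `b ∈ CMO(ℝⁿ)`: `b` lies in the closure of `C_c^∞(ℝⁿ)` in the BMO seminorm. -/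
def MemCMO (n : ℕ) (b : Rn n → ℝ) : Prop :=
  LocallyIntegrable b volume ∧
  ∀ ε : ℝ, 0 < ε → ∃ g : Rn n → ℝ, ContDiff ℝ (⊤ : ℕ∞) g ∧ HasCompactSupport g ∧
    bmoNorm n (fun x => b x - g x) ≤ ENNReal.ofReal ε

/-- The bilinear fractional integral operator `B_α`. -/
def Bop (n : ℕ) (α : ℝ) (f g : Rn n → ℝ) (x : Rn n) : ℝ :=
  ∫ y, f (x - y) * g (x + y) * ‖y‖ ^ (α - n)

/-- The first commutator `[b, B_α]₁`. -/
def commB (n : ℕ) (α : ℝ) (b f g : Rn n → ℝ) (x : Rn n) : ℝ :=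
  ∫ y, (b x - b y) * f y * g ((2 : ℝ) • x - y) * ‖x - y‖ ^ (α - n)

/-- The bilinear fractional integral operator `I_α`. -/
def Iop (n : ℕ) (α : ℝ) (f₁ f₂ : Rn n → ℝ) (x : Rn n) : ℝ :=
  ∫ y₁, ∫ y₂, f₁ y₁ * f₂ y₂ * (‖x - y₁‖ ^ 2 + ‖x - y₂‖ ^ 2) ^ (α / 2 - n)

/-- The iterated commutator `[Πb⃗, I_α]` with `b⃗ = (b, b)`. -/
def commI (n : ℕ) (α : ℝ) (b f₁ f₂ : Rn n → ℝ) (x : Rn n) : ℝ :=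
  ∫ y₁, ∫ y₂, (b x - b y₁) * (b x - b y₂) * f₁ y₁ * f₂ y₂ *
    (‖x - y₁‖ ^ 2 + ‖x - y₂‖ ^ 2) ^ (α / 2 - n)

/-- The Muckenhoupt class `A_p`. -/
def MemAp (n : ℕ) (p : ℝ) (w : Rn n → ℝ) : Prop :=
  ∃ C : ℝ, ∀ (c : Rn n) (r : ℝ), 0 < r →
    ((volume (cube n c r)).toReal⁻¹ * ∫ x in cube n c r, w x) *
      ((volume (cube n c r)).toReal⁻¹ * ∫ x in cube n c r, w x ^ (-(1 / (p - 1)))) ^ (p - 1) ≤ C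

/-- The bilinear weight class `A_{P,q}` with `P = (p₁, p₂)`. -/
def MemAPq (n : ℕ) (p₁ p₂ q : ℝ) (w₁ w₂ : Rn n → ℝ) : Prop :=
  ∃ C : ℝ, ∀ (c : Rn n) (r : ℝ), 0 < r →
    ((volume (cube n c r)).toReal⁻¹ * ∫ x in cube n c r, w₁ x ^ q * w₂ x ^ q) *
      ((volume (cube n c r)).toReal⁻¹ *
          ∫ x in cube n c r, w₁ x ^ (-(1 - 1 / p₁)⁻¹)) ^ (q * (1 - 1 / p₁)) *
      ((volume (cube n c r)).toReal⁻¹ *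
          ∫ x in cube n c r, w₂ x ^ (-(1 - 1 / p₂)⁻¹)) ^ (q * (1 - 1 / p₂)) ≤ C

lemma norm_sub_le_of_mem_cube {n : ℕ} (hn : 1 ≤ n) {c z : Rn n} {r : ℝ} (hr : 0 < r)
    (hz : z ∈ cube n c r) : ‖z - c‖ ≤ n * r / 2 := by
  have h1 : (1 : ℝ) ≤ n := by exact_mod_cast hn
  refine le_of_sq_le_sq ?_ (by positivity)
  calc ‖z - c‖ ^ 2 = ∑ i, (z i - c i) ^ 2 := by
        simp [EuclideanSpace.real_norm_sq_eq]
    _ ≤ ∑ _i : Fin n, (r / 2) ^ 2 :=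
        Finset.sum_le_sum fun i _ => sq_le_sq' (abs_le.1 (hz i)).1 (abs_le.1 (hz i)).2
    _ = n * (r / 2) ^ 2 := by simp
    _ ≤ (n * (n : ℝ)) * (r / 2) ^ 2 := by
        gcongr
        nlinarith
    _ = (n * r / 2) ^ 2 := by ring

lemma lt_norm_sub_of_notMem_cube {n : ℕ} {c x : Rn n} {s : ℝ} (hx : x ∉ cube n c s) :
    s / 2 < ‖x - c‖ := by
  simp only [cube, Set.mem_ofPred_eq, not_forall, not_le] at hx
  obtain ⟨i, hi⟩ := hx
  exact hi.trans_le (PiLp.norm_apply_le (x - c) i)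

lemma volume_cube_lt_top {n : ℕ} (hn : 1 ≤ n) (c : Rn n) {r : ℝ} (hr : 0 < r) :
    volume (cube n c r) < ⊤ :=
  (Metric.isBounded_closedBall.subset fun z hz => by
    simpa [dist_eq_norm] using norm_sub_le_of_mem_cube hn hr hz :
      Bornology.IsBounded (cube n c r)).measure_lt_top

lemma Bop_eq_integral_sub (n : ℕ) (α : ℝ) (f g : Rn n → ℝ) (x : Rn n) :
    Bop n α f g x = ∫ z, f z * g (x + (x - z)) * ‖x - z‖ ^ (α - n) := by
  rw [Bop, ← integral_sub_left_eq_self _ volume x]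
  simp

/-- pointwise upper bound `|B_α(f, g)(x)| ≲ |Q|^{1/p₁'+1}
|x - x_Q|^{-2n - n/p₂ + α}` for `x ∈ (2nQ)^c`, for any `f` supported in `Q` with
`|f| ≤ |Q|^{-1/p₁}`. -/
theorem statement8 (n : ℕ) (hn : 1 ≤ n) (α p₁ p₂ : ℝ)
    (hα : 0 < α) (hαn : α < n) (hp₁ : 1 < p₁) (hp₂ : 1 < p₂) :
    ∃ C : ℝ, ∀ (c : Rn n) (r : ℝ), 0 < r →
      ∀ f : Rn n → ℝ, Measurable f →
      (∀ y, y ∉ cube n c r → f y = 0) →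
      (∀ y, |f y| ≤ (volume (cube n c r)).toReal ^ (-(1 / p₁))) →
      ∀ x : Rn n, x ∉ cube n c (2 * n * r) →
        |Bop n α f
            ((cube n c (2 * r))ᶜ.indicator fun y =>
              (volume (cube n c r)).toReal * ‖y - c‖ ^ (-(↑n / p₂ + ↑n)))
            x| ≤
          C * (volume (cube n c r)).toReal ^ (1 - 1 / p₁ + 1) *
            ‖x - c‖ ^ (-(2 * n) - n / p₂ + α) := by
  refine ⟨2 ^ (n - α), fun c r hr f _ hf0 hf x hx => ?_⟩
  have hu : n * r < ‖x - c‖ := by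
    have := lt_norm_sub_of_notMem_cube hx
    linarith
  have hn0 : (0 : ℝ) < n := by linarith
  have hu0 : 0 < ‖x - c‖ := lt_trans (by positivity) hu
  set V := (volume (cube n c r)).toReal with hV
  have hV0 : 0 ≤ V := ENNReal.toReal_nonneg
  rw [Bop_eq_integral_sub, ← setIntegral_eq_integral_of_forall_compl_eq_zero
    (s := cube n c r) (fun z hz => by simp [hf0 z hz]), ← Real.norm_eq_abs]
  have hbound : ∀ z ∈ cube n c r, ‖f z * (cube n c (2 * r))ᶜ.indicator
      (fun y => V * ‖y - c‖ ^ (-(↑n / p₂ + ↑n))) (x + (x - z)) * ‖x - z‖ ^ (α - n)‖ ≤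
      V ^ (-(1 / p₁)) * (V * ‖x - c‖ ^ (-(↑n / p₂ + ↑n))) * (‖x - c‖ / 2) ^ (α - n) := by
    intro z hz
    have hw := norm_sub_le_of_mem_cube hn hr hz
    have hy : ‖x - c‖ / 2 ≤ ‖x - z‖ := by
      have h := norm_sub_norm_le (x - c) (z - c)
      rw [sub_sub_sub_cancel_right] at h
      linarith
    have hxy : ‖x - c‖ ≤ ‖x + (x - z) - c‖ := by
      have h := norm_sub_norm_le ((2 : ℝ) • (x - c)) (z - c)
      rw [norm_smul, Real.norm_ofNat,
        show (2 : ℝ) • (x - c) - (z - c) = x + (x - z) - c by module] at h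
      linarith
    rw [norm_mul, norm_mul, Real.norm_eq_abs (f z),
      Real.norm_of_nonneg (Real.rpow_nonneg (norm_nonneg (x - z)) _)]
    refine mul_le_mul (mul_le_mul (hf z) ?_ (norm_nonneg _) (by positivity)) ?_
      (by positivity) (by positivity)
    · refine (norm_indicator_le_norm_self _ _).trans ?_
      rw [Real.norm_of_nonneg (by positivity)]
      exact mul_le_mul_of_nonneg_left (Real.rpow_le_rpow_of_nonpos hu0 hxy
        (neg_nonpos.2 (by positivity))) hV0
    · exact Real.rpow_le_rpow_of_nonpos (by positivity) hy (by linarith)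
  refine (norm_setIntegral_le_of_norm_le_const (volume_cube_lt_top hn c hr) hbound).trans_eq ?_
  have hp : 1 / p₁ < 1 := (div_lt_one (by linarith)).2 hp₁
  rw [measureReal_def, ← hV, Real.div_rpow hu0.le zero_le_two,
    Real.rpow_add_one' hV0 (by linarith), show 1 - 1 / p₁ = -(1 / p₁) + 1 by ring,
    Real.rpow_add_one' hV0 (by linarith), show (n : ℝ) - α = -(α - n) by ring,
    Real.rpow_neg zero_le_two,
    show -(2 * (n : ℝ)) - n / p₂ + α = -(n / p₂ + n) + (α - n) by ring, Real.rpow_add hu0]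
  ring
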